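/- A Weyl group element maps every positive long root to a positive long root if and only if it lies in the parabolic subgroup generated by the short simple reflections; that is, W(Π_s) = {w ∈ W : w(Δ_l⁺) ⊆ Δ_l⁺}. -/

import Mathlib

open scoped RealInnerProductSpace

/-- The orthogonal reflection of a Euclidean space in the hyperplane orthogonal to `α`
(for `α ≠ 0` this is the usual reflection `x ↦ x - 2(x|α)/(α|α) α`). -/
noncomputable def rrefl {E : Type} [NormedAddCommGroup E] [InnerProductSpace ℝ E]
    [FiniteDimensional ℝ E] (α : E) : E ≃ₗᵢ[ℝ] E :=
  Submodule.reflection ((ℝ ∙ α)ᗮ)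

/-- The group generated by the reflections `r_α` for `α ∈ S`. -/
noncomputable def weylOf {E : Type} [NormedAddCommGroup E] [InnerProductSpace ℝ E]
    [FiniteDimensional ℝ E] (S : Set E) : Subgroup (E ≃ₗᵢ[ℝ] E) :=
  Subgroup.closure (rrefl '' S)


section helpers

variable {E : Type} [NormedAddCommGroup E] [InnerProductSpace ℝ E] [FiniteDimensional ℝ E]

lemma rrefl_apply (α x : E) : rrefl α x = x - (2 * (⟪α, x⟫ / ‖α‖ ^ 2)) • α := by
  unfold rrefl
  rw [Submodule.reflection_orthogonal_apply, Submodule.reflection_singleton_apply]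
  simp only [RCLike.ofReal_real_eq_id, id, neg_sub, mul_smul, two_smul]

lemma rrefl_self (α : E) : rrefl α α = -α :=
  Submodule.reflection_orthogonalComplement_singleton_eq_neg α

lemma rrefl_mul_self (α : E) : rrefl α * rrefl α = 1 :=
  Submodule.reflection_mul_reflection _

lemma rrefl_rrefl (α x : E) : rrefl α (rrefl α x) = x :=
  Submodule.reflection_reflection _ x

lemma rrefl_neg (α : E) : rrefl (-α) = rrefl α := by
  ext x
  simp [rrefl_apply, neg_div]

lemma rrefl_conj (u : E ≃ₗᵢ[ℝ] E) (α : E) : rrefl (u α) * u = u * rrefl α := by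
  ext x
  simp [rrefl_apply]

lemma exists_functional {Φ : Set E} (hΦind : LinearIndependent ℝ (fun a : Φ => (a : E)))
    (g : E → ℝ) : ∃ f : E →ₗ[ℝ] ℝ, ∀ a ∈ Φ, f a = g a := by
  have h : LinearIndepOn ℝ id Φ := hΦind
  refine ⟨(Module.Basis.extend h).constr ℝ (fun i => g i), fun a ha => ?_⟩
  have h1 := (Module.Basis.extend h).constr_basis ℝ (fun i => g i)
    ⟨a, Module.Basis.subset_extend h ha⟩
  rwa [Module.Basis.extend_apply_self] at h1

/-- Simple reflections permute the other positive roots. -/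
lemma simple_pos {Δ Δp Φ : Set E}
    (hrefl : ∀ α ∈ Δ, ∀ β ∈ Δ, rrefl α β ∈ Δ)
    (hred : ∀ α ∈ Δ, ∀ t : ℝ, t • α ∈ Δ → t = 1 ∨ t = -1)
    (hΔpΔ : Δp ⊆ Δ) (hpm : ∀ α ∈ Δ, α ∈ Δp ↔ -α ∉ Δp)
    (hΦp : Φ ⊆ Δp)
    (hΦind : LinearIndependent ℝ (fun a : Φ => (a : E)))
    (hΦdec : ∀ γ ∈ Δp, ∃ c : E →₀ ℕ, ↑c.support ⊆ Φ ∧ γ = c.sum fun α n => (n : ℝ) • α)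
    {α β : E} (hα : α ∈ Φ) (hβ : β ∈ Δp) (hne : β ≠ α) : rrefl α β ∈ Δp := by
  classical
  by_contra hn
  have hr : rrefl α β ∈ Δ := hrefl α (hΔpΔ (hΦp hα)) β (hΔpΔ hβ)
  have hneg : -rrefl α β ∈ Δp := by
    by_contra h
    exact hn ((hpm _ hr).2 h)
  obtain ⟨c, hc, hcβ⟩ := hΦdec β hβ
  obtain ⟨d, hd, hdβ⟩ := hΦdec _ hneg
  have key : ∀ γ, γ ≠ α → c γ = 0 := by
    intro γ hγα
    by_contra hcγ
    have hγ : γ ∈ Φ := hc (by simpa using hcγ)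
    obtain ⟨f, hf⟩ := exists_functional hΦind (fun x => if x = γ then 1 else 0)
    have ev : ∀ e : E →₀ ℕ, ↑e.support ⊆ Φ →
        f (e.sum fun α n => (n : ℝ) • α) = e γ := by
      intro e he
      rw [Finsupp.sum, map_sum, Finset.sum_congr rfl
        (g := fun x => if x = γ then (e x : ℝ) else 0)]
      · rw [Finset.sum_ite_eq']
        by_cases h : e γ = 0 <;> simp [h]
      · intro x hx
        rw [map_smul, hf x (he hx)]
        simp
    have h1 := ev c hc
    have h2 := ev d hd
    rw [← hcβ] at h1
    rw [← hdβ, rrefl_apply, map_neg, map_sub, map_smul, hf α hα, if_neg (Ne.symm hγα), h1] at h2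
    simp only [smul_zero, sub_zero] at h2
    have h3 : (0 : ℝ) < c γ := by positivity
    have h4 : (0 : ℝ) ≤ d γ := by positivity
    linarith
  have hβα : β = (c α : ℝ) • α := by
    rw [hcβ, Finsupp.sum]
    rw [Finset.sum_eq_single α]
    · intro b _ hb
      simp [key b hb]
    · intro h
      have : c α = 0 := by simpa using h
      simp [this]
  rcases hred α (hΔpΔ (hΦp hα)) (c α) (hβα ▸ hΔpΔ hβ) with h | h
  · rw [h, one_smul] at hβα
    exact hne hβα
  · have h4 : (0 : ℝ) ≤ c α := by positivity
    linarith

lemma refl_mem {Δ Δp Φ : Set E} (h0 : (0 : E) ∉ Δ)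
    (hΔpΔ : Δp ⊆ Δ) (hΦp : Φ ⊆ Δp)
    (hΦind : LinearIndependent ℝ (fun a : Φ => (a : E)))
    (hΦdec : ∀ γ ∈ Δp, ∃ c : E →₀ ℕ, ↑c.support ⊆ Φ ∧ γ = c.sum fun α n => (n : ℝ) • α)
    (hsp : ∀ α ∈ Φ, ∀ β ∈ Δp, β ≠ α → rrefl α β ∈ Δp) :
    ∀ β ∈ Δp, rrefl β ∈ weylOf Φ := by
  obtain ⟨f, hf⟩ := exists_functional hΦind (fun _ => 1)
  have hnat : ∀ β ∈ Δp, ∃ n : ℕ, f β = n := by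
    intro β hβ
    obtain ⟨c, hc, rfl⟩ := hΦdec β hβ
    refine ⟨∑ a ∈ c.support, c a, ?_⟩
    rw [Finsupp.sum, map_sum, Nat.cast_sum]
    refine Finset.sum_congr rfl fun x hx => ?_
    rw [map_smul, hf x (hc hx)]
    simp
  have main : ∀ n : ℕ, ∀ β ∈ Δp, f β = n → rrefl β ∈ weylOf Φ := by
    intro n
    induction n using Nat.strong_induction_on with
    | _ n ih =>
      intro β hβ hn
      have hβ0 : β ≠ 0 := fun h => h0 (h ▸ hΔpΔ hβ)
      have hex : ∃ α ∈ Φ, 0 < ⟪α, β⟫ := by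
        by_contra! hcon
        obtain ⟨c, hc, hcβ⟩ := hΦdec β hβ
        have h1 : ⟪β, β⟫ ≤ 0 := by
          nth_rewrite 1 [hcβ]
          rw [Finsupp.sum, sum_inner]
          refine Finset.sum_nonpos fun x hx => ?_
          rw [real_inner_smul_left]
          exact mul_nonpos_of_nonneg_of_nonpos (by positivity) (hcon x (hc hx))
        exact absurd (real_inner_self_pos.2 hβ0) (not_lt.2 h1)
      obtain ⟨α, hα, hpos⟩ := hex
      have hαm : rrefl α ∈ weylOf Φ := Subgroup.subset_closure ⟨α, hα, rfl⟩
      by_cases hne : β = α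
      · rwa [hne]
      · have hm := hsp α hα β hβ hne
        obtain ⟨m, hm'⟩ := hnat _ hm
        have hα0 : α ≠ 0 := fun h => h0 (h ▸ hΔpΔ (hΦp hα))
        have hlt : m < n := by
          have : 0 < 2 * (⟪α, β⟫ / ‖α‖ ^ 2) := by positivity
          have h2 := hm'
          rw [rrefl_apply, map_sub, map_smul, hf α hα, hn, smul_eq_mul, mul_one] at h2
          have : (m : ℝ) < n := by linarith
          exact_mod_cast this
        have h3 := ih m hlt _ hm hm'
        have h4 : rrefl β = rrefl α * rrefl (rrefl α β) * rrefl α := by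
          rw [mul_assoc, rrefl_conj, ← mul_assoc, rrefl_mul_self, one_mul]
        rw [h4]
        exact mul_mem (mul_mem hαm h3) hαm
  intro β hβ
  obtain ⟨n, hn⟩ := hnat β hβ
  exact main n β hβ hn

lemma exists_word {Φ : Set E} {w : E ≃ₗᵢ[ℝ] E} (hw : w ∈ weylOf Φ) :
    ∃ L : List E, (∀ a ∈ L, a ∈ Φ) ∧ w = (L.map rrefl).prod := by
  unfold weylOf at hw
  induction hw using Subgroup.closure_induction with
  | mem x hx =>
    obtain ⟨a, ha, rfl⟩ := hx
    exact ⟨[a], by simpa using ha, by simp⟩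
  | one => exact ⟨[], by simp, by simp⟩
  | mul x y _ _ hx hy =>
    obtain ⟨L, hL, rfl⟩ := hx
    obtain ⟨M, hM, rfl⟩ := hy
    refine ⟨L ++ M, ?_, by simp⟩
    intro a ha
    rcases List.mem_append.1 ha with h | h
    · exact hL a h
    · exact hM a h
  | inv x _ hx =>
    obtain ⟨L, hL, rfl⟩ := hx
    refine ⟨L.reverse, by simpa using hL, ?_⟩
    rw [List.prod_inv_reverse, List.map_map, List.map_reverse]
    rfl

lemma exchange {Δ Δp Φ : Set E}
    (hrefl : ∀ α ∈ Δ, ∀ β ∈ Δ, rrefl α β ∈ Δ)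
    (hΔpΔ : Δp ⊆ Δ) (hΦp : Φ ⊆ Δp)
    (hsp : ∀ α ∈ Φ, ∀ β ∈ Δp, β ≠ α → rrefl α β ∈ Δp) {α : E} (hα : α ∈ Φ) :
    ∀ L : List E, (∀ a ∈ L, a ∈ Φ) → (L.map rrefl).prod α ∉ Δp →
      ∃ L' : List E, (∀ a ∈ L', a ∈ Φ) ∧ L'.length < L.length ∧
        (L.map rrefl).prod = (L'.map rrefl).prod * rrefl α := by
  intro L
  induction L with
  | nil => intro _ h; exact absurd (hΦp hα) (by simpa using h)
  | cons b L ih =>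
    intro hL hneg
    have hb : b ∈ Φ := hL b (by simp)
    have hL' : ∀ a ∈ L, a ∈ Φ := fun a ha => hL a (by simp [ha])
    rw [List.map_cons, List.prod_cons] at hneg ⊢
    by_cases h : (L.map rrefl).prod α ∈ Δp
    · have heq : (L.map rrefl).prod α = b := by
        by_contra hne
        exact hneg (hsp b hb _ h hne)
      refine ⟨L, hL', by simp, ?_⟩
      rw [← rrefl_conj, heq]
    · obtain ⟨L', h1, h2, h3⟩ := ih hL' h
      refine ⟨b :: L', ?_, by simpa using h2, ?_⟩
      · intro a ha
        rcases List.mem_cons.1 ha with rfl | h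
        · exact hb
        · exact h1 a h
      · rw [h3, List.map_cons, List.prod_cons, mul_assoc]

end helpers

/-- A Weyl group element maps every positive long root to a positive long
root if and only if it lies in the parabolic subgroup `W(Πs)` generated by the short simple
reflections: `W(Πs) = {w ∈ W : w(Δl⁺) ⊆ Δl⁺}`. -/
theorem statement0
    {E : Type} [NormedAddCommGroup E] [InnerProductSpace ℝ E] [FiniteDimensional ℝ E]
    (Δ Δs Δl Δp Φ Φs : Set E)
    -- `Δ` is a finite set of nonzero vectors spanning `E`
    (hfin : Δ.Finite) (h0 : (0 : E) ∉ Δ)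
    (hspan : Submodule.span ℝ Δ = ⊤)
    -- stable under all root reflections
    (hrefl : ∀ α ∈ Δ, ∀ β ∈ Δ, rrefl α β ∈ Δ)
    -- crystallographic
    (hcrys : ∀ α ∈ Δ, ∀ β ∈ Δ, ∃ n : ℤ, 2 * ⟪β, α⟫ / ⟪α, α⟫ = (n : ℝ))
    -- reduced
    (hred : ∀ α ∈ Δ, ∀ t : ℝ, t • α ∈ Δ → t = 1 ∨ t = -1)
    -- irreducible
    (hirr : ∀ A B : Set E, A ∪ B = Δ → (∀ a ∈ A, ∀ b ∈ B, ⟪a, b⟫ = 0) → A = ∅ ∨ B = ∅)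
    -- two root lengths: `Δs` are the short roots, `Δl` the long ones
    (ls ll : ℝ) (h0ls : 0 < ls) (hlsll : ls < ll)
    (hΔs : Δs = {α ∈ Δ | ‖α‖ = ls}) (hΔl : Δl = {α ∈ Δ | ‖α‖ = ll})
    (hcover : Δ = Δs ∪ Δl) (hsne : Δs.Nonempty) (hlne : Δl.Nonempty)
    -- `Δp` is a positive system: for each root exactly one of `±α` is positive
    (hΔpΔ : Δp ⊆ Δ) (hpm : ∀ α ∈ Δ, α ∈ Δp ↔ -α ∉ Δp)
    -- `Φ` is the corresponding set of simple roots, `Φs = Φ ∩ Δs` the short simple roots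
    (hΦp : Φ ⊆ Δp)
    (hΦind : LinearIndependent ℝ (fun a : Φ => (a : E)))
    (hΦdec : ∀ γ ∈ Δp, ∃ c : E →₀ ℕ, ↑c.support ⊆ Φ ∧ γ = c.sum fun α n => (n : ℝ) • α)
    (hΦs : Φs = Φ ∩ Δs)
 :
    ∀ w : E ≃ₗᵢ[ℝ] E,
      w ∈ weylOf Φs ↔ w ∈ weylOf Δ ∧ ∀ γ ∈ Δl ∩ Δp, w γ ∈ Δl ∩ Δp := by
  have hsp : ∀ α ∈ Φ, ∀ β ∈ Δp, β ≠ α → rrefl α β ∈ Δp := fun α hα β hβ hne =>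
    simple_pos hrefl hred hΔpΔ hpm hΦp hΦind hΦdec hα hβ hne
  have hshort : ∀ α ∈ Φs, ∀ γ ∈ Δl ∩ Δp, rrefl α γ ∈ Δl ∩ Δp := by
    intro α hα γ hγ
    rw [hΦs, hΔs] at hα
    rw [hΔl] at hγ ⊢
    obtain ⟨hαΦ, hαΔ, hαl⟩ := hα
    obtain ⟨⟨hγΔ, hγl⟩, hγp⟩ := hγ
    refine ⟨⟨hrefl α hαΔ γ hγΔ, by rw [LinearIsometryEquiv.norm_map, hγl]⟩,
      hsp α hαΦ γ hγp ?_⟩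
    rintro rfl
    linarith
  have hsub : weylOf Φs ≤ weylOf Δ := by
    apply Subgroup.closure_mono
    apply Set.image_mono
    rw [hΦs]
    exact fun x hx => hΔpΔ (hΦp hx.1)
  have hgen : weylOf Δ ≤ weylOf Φ := by
    unfold weylOf
    rw [Subgroup.closure_le]
    rintro _ ⟨β, hβ, rfl⟩
    have hm := refl_mem h0 hΔpΔ hΦp hΦind hΦdec hsp
    by_cases h : β ∈ Δp
    · exact hm β h
    · have h' : -β ∈ Δp := by
        by_contra h''
        exact h ((hpm β hβ).2 h'')
      have := hm _ h'
      rwa [rrefl_neg] at this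
  intro w
  constructor
  · intro hw
    refine ⟨hsub hw, ?_⟩
    obtain ⟨L, hL, rfl⟩ := exists_word hw
    clear hw
    induction L with
    | nil => intro γ hγ; simpa using hγ
    | cons b L ih =>
      intro γ hγ
      rw [List.map_cons, List.prod_cons]
      exact hshort b (hL b (by simp)) _ (ih (fun a ha => hL a (by simp [ha])) γ hγ)
  · rintro ⟨hw, hpres⟩
    obtain ⟨L, hL, hwL⟩ := exists_word (hgen hw)
    have main : ∀ n : ℕ, ∀ L : List E, L.length = n → (∀ a ∈ L, a ∈ Φ) →
        (∀ γ ∈ Δl ∩ Δp, (L.map rrefl).prod γ ∈ Δl ∩ Δp) →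
        (L.map rrefl).prod ∈ weylOf Φs := by
      intro n
      induction n using Nat.strong_induction_on with
      | _ n ih =>
        intro L hn hL hp
        rcases List.eq_nil_or_concat L with rfl | ⟨M, α, rfl⟩
        · simp [one_mem]
        · have hα : α ∈ Φ := hL α (by simp)
          have hM : ∀ a ∈ M, a ∈ Φ := fun a ha => hL a (by simp [ha])
          have hprod : ((M.concat α).map rrefl).prod = (M.map rrefl).prod * rrefl α := by
            simp
          have hlen : M.length < n := by rw [← hn]; simp
          rw [hprod] at hp ⊢
          have hαΔ := hΔpΔ (hΦp hα)
          by_cases hM1 : (M.map rrefl).prod α ∈ Δp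
          · have hαs : α ∈ Φs := by
              rw [hΦs]
              refine ⟨hα, ?_⟩
              have h1 := hαΔ
              rw [hcover] at h1
              rcases h1 with h1 | h1
              · exact h1
              · exfalso
                have h2 := (hp α ⟨h1, hΦp hα⟩).2
                rw [LinearIsometryEquiv.coe_mul, Function.comp_apply, rrefl_self, map_neg] at h2
                exact (hpm _ (hΔpΔ hM1)).1 hM1 h2
            refine mul_mem (ih _ hlen M rfl hM ?_) (Subgroup.subset_closure ⟨α, hαs, rfl⟩)
            intro γ hγ
            have := hp _ (hshort α hαs γ hγ)
            rwa [LinearIsometryEquiv.coe_mul, Function.comp_apply, rrefl_rrefl] at this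
          · obtain ⟨L', h1, h2, h3⟩ := exchange hrefl hΔpΔ hΦp hsp hα M hM hM1
            rw [h3, mul_assoc, rrefl_mul_self, mul_one] at hp ⊢
            exact ih _ (h2.trans hlen) L' rfl h1 hp
    rw [hwL]
    refine main _ L rfl hL ?_
    rw [← hwL]
    exact hpres
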